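/- (Theorem 1: the Hasse diagram summarization is correct and complete.) Assume the DAG hypothesis and let R' be any transitive reduction of R. Then: (correctness) for every list p with List.Chain' R' p and every agent i, the list p.filter (· ∈ L i) is a sublist (List.Sublist) of L i; and (completeness) for every agent i there exists a list p with List.Chain' R' p and p.filter (· ∈ L i) = L i. -/

import Mathlib

theorem List.IsChain.pairwise_transGen {α : Type*} {r : α → α → Prop} {l : List α}
    (h : l.IsChain r) : l.Pairwise (Relation.TransGen r) :=
  List.isChain_iff_pairwise.1 (h.imp fun _ _ hab => Relation.TransGen.single hab)

theorem Relation.TransGen.exists_isChain_cons {α : Type*} {r : α → α → Prop} {a b : α}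
    (hab : Relation.TransGen r a b) {l : List α} (hl : (b :: l).IsChain r) :
    ∃ q : List α, (a :: q).IsChain r ∧ (b :: l).Sublist q := by
  induction hab using Relation.TransGen.head_induction_on with
  | single h => exact ⟨b :: l, List.isChain_cons_cons.2 ⟨h, hl⟩, .refl _⟩
  | @head x y hxy _ ih =>
    obtain ⟨q, hq, hs⟩ := ih
    exact ⟨y :: q, List.isChain_cons_cons.2 ⟨hxy, hq⟩, hs.cons y⟩

/-- A chain for the transitive closure refines to a chain for the relation itself. -/
theorem List.IsChain.exists_isChain_cons_of_transGen {α : Type*} {r : α → α → Prop} {a : α}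
    {l : List α} (h : (a :: l).IsChain (Relation.TransGen r)) :
    ∃ q : List α, (a :: q).IsChain r ∧ l.Sublist q := by
  induction l generalizing a with
  | nil => exact ⟨[], List.isChain_singleton a, .refl _⟩
  | cons b l ih =>
    obtain ⟨hab, hl⟩ := List.isChain_cons_cons.1 h
    obtain ⟨q, hq, hs⟩ := ih hl
    obtain ⟨q', hq', hs'⟩ := hab.exists_isChain_cons hq
    exact ⟨q', hq', (hs.cons_cons b).trans hs'⟩

/-- Theorem 1: the Hasse-diagram summarization is correct and
complete, for any transitive reduction `R'` of `R`, under the DAG hypothesis. -/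
theorem stmt7 {α : Type*} [DecidableEq α] {N : ℕ} (L : Fin N → List α)
    (hnd : ∀ i, (L i).Nodup)
    (R : α → α → Prop)
    (hR : ∀ a b, R a b ↔ ∃ i, [a, b] <:+: L i)
    (hdag : Irreflexive (Relation.TransGen R))
    (R' : α → α → Prop) (hle : R' ≤ R)
    (hcl : Relation.ReflTransGen R' = Relation.ReflTransGen R) :
    (∀ p : List α, List.Chain' R' p → ∀ i : Fin N,
        (p.filter (· ∈ L i)).Sublist (L i)) ∧
    (∀ i : Fin N, ∃ p : List α, List.Chain' R' p ∧ p.filter (· ∈ L i) = L i) := by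
  have hchain : ∀ i, (L i).IsChain R := fun i =>
    List.isChain_iff_forall_rel_of_append_cons_cons.2 fun a b l₁ l₂ h =>
      (hR a b).2 ⟨i, l₁, l₂, by simp [h]⟩
  have : Std.Irrefl (Relation.TransGen R) := ⟨hdag⟩
  have : Std.Antisymm (Relation.TransGen R) :=
    ⟨fun a _ hab hba => (hdag a (hab.trans hba)).elim⟩
  have correct : ∀ p : List α, List.IsChain R' p → ∀ i : Fin N,
      (p.filter (· ∈ L i)).Sublist (L i) := by
    intro p hp i
    have hpw : (p.filter (· ∈ L i)).Pairwise (Relation.TransGen R) :=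
      (hp.imp hle).pairwise_transGen.filter _
    have hsub : (p.filter (· ∈ L i)).Subperm (L i) :=
      hpw.nodup.subperm fun x hx => by
        simpa using (List.mem_filter.1 hx).2
    exact List.sublist_of_subperm_of_pairwise hsub hpw (hchain i).pairwise_transGen
  have hR' : ∀ a b, R a b → Relation.TransGen R' a b := by
    intro a b hab
    have h : Relation.ReflTransGen R' a b := hcl ▸ Relation.ReflTransGen.single hab
    rcases Relation.reflTransGen_iff_eq_or_transGen.1 h with rfl | h
    · exact (hdag _ (.single hab)).elim
    · exact h
  refine ⟨correct, fun i => ?_⟩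
  obtain ⟨p, hp, hs⟩ : ∃ p : List α, p.IsChain R' ∧ (L i).Sublist p := by
    have h := (hchain i).imp hR'
    cases hl : L i with
    | nil => exact ⟨[], .nil, .refl _⟩
    | cons a l =>
      rw [hl] at h
      obtain ⟨q, hq, hs⟩ := h.exists_isChain_cons_of_transGen
      exact ⟨a :: q, hq, hs.cons_cons a⟩
  refine ⟨p, hp, (correct p hp i).antisymm ?_⟩
  have hself : (L i).filter (· ∈ L i) = L i := List.filter_eq_self.2 fun _ hx => decide_eq_true hx
  simpa only [hself] using hs.filter (· ∈ L i)
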